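/- arXiv:2211.14707 — 2 statements merged into one kernel-verified Lean document; each statement's English description precedes it below -/
import Mathlib

section
/- Every quasicontinuous domain is quasiexact. -/
open Set TopologicalSpace

variable {α : Type*}

/-- The upper closure `↑A = {p : ∃ a ∈ A, a ≤ p}`. -/
def upSet [PartialOrder α] (A : Set α) : Set α := {p | ∃ a ∈ A, a ≤ p}

/-- The lower closure `↓A = {p : ∃ a ∈ A, p ≤ a}`. -/
def downSet [PartialOrder α] (A : Set α) : Set α := {p | ∃ a ∈ A, p ≤ a}

/-- A nonempty subset `D` is directed if every two elements have an upper bound in `D`. -/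
def IsDirectedSet [PartialOrder α] (D : Set α) : Prop :=
  D.Nonempty ∧ ∀ a ∈ D, ∀ b ∈ D, ∃ c ∈ D, a ≤ c ∧ b ≤ c

/-- `G` is weakly way below `H` (`G ≪_w H`): for every directed `D` whose sup exists,
`sup D ∈ H` implies `d ∈ ↑G` for some `d ∈ D`. -/
def WWB [PartialOrder α] (G H : Set α) : Prop :=
  ∀ D : Set α, IsDirectedSet D → ∀ s : α, IsLUB D s → s ∈ H → ∃ d ∈ D, d ∈ upSet G

/-- `↟_w G = {a : G ≪_w a}`. -/
def wUp [PartialOrder α] (G : Set α) : Set α := {a | WWB G {a}}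

/-- `fin_w(x)`: all finite nonempty subsets `F` with `F ≪_w x`. -/
def finW [PartialOrder α] (x : α) : Set (Set α) :=
  {F | F.Finite ∧ F.Nonempty ∧ WWB F {x}}

/-- `fin_(bl)w(x) = {F ∈ fin_w(x) : F ⊆ ↓x}`. -/
def finBlW [PartialOrder α] (x : α) : Set (Set α) :=
  {F | F ∈ finW x ∧ F ⊆ downSet {x}}

/-- A family `𝓕` of subsets is directed if for `F₁, F₂ ∈ 𝓕` there is `F₃ ∈ 𝓕`
with `F₃ ⊆ ↑F₁ ∩ ↑F₂`. -/
def DirectedFam [PartialOrder α] (𝓕 : Set (Set α)) : Prop :=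
  ∀ F₁ ∈ 𝓕, ∀ F₂ ∈ 𝓕, ∃ F₃ ∈ 𝓕, F₃ ⊆ upSet F₁ ∩ upSet F₂

/-- `P` is quasiexact if for each `x` the family `fin_w(x)` is directed and
`⋂ {↑F : F ∈ fin_w(x)} = ↑x`. -/
def Quasiexact (α : Type*) [PartialOrder α] : Prop :=
  ∀ x : α, DirectedFam (finW x) ∧ (⋂ F ∈ finW x, upSet F) = upSet {x}

/-- A dcpo: every directed subset has a supremum. -/
def IsDcpo (α : Type*) [PartialOrder α] : Prop :=
  ∀ D : Set α, IsDirectedSet D → ∃ s : α, IsLUB D s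

/-- The wf topology: generated by the subbasis `{↟_w F : F finite nonempty}`. -/
def wfTopology (α : Type*) [PartialOrder α] : TopologicalSpace α :=
  generateFrom {U | ∃ F : Set α, F.Finite ∧ F.Nonempty ∧ U = wUp F}

/-- The wwb topology: generated by the subbasis `{↟_w x : x ∈ P}`. -/
def wwbTopology (α : Type*) [PartialOrder α] : TopologicalSpace α :=
  generateFrom {U | ∃ x : α, U = wUp {x}}

/-- `P` is moderately meet continuous: `x ≤ sup D` implies
`x ∈ cl_{τ_wf}(↓D ∩ ↓x)` for every directed `D` whose sup exists. -/
def ModMeetCont (α : Type*) [PartialOrder α] : Prop :=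
  ∀ x : α, ∀ D : Set α, IsDirectedSet D → ∀ s : α, IsLUB D s → x ≤ s →
    x ∈ @closure α (wfTopology α) (downSet D ∩ downSet {x})

/-- `U` is Scott open: `U = ↑U` and every directed set whose sup lies in `U` meets `U`. -/
def IsScottOpen [PartialOrder α] (U : Set α) : Prop :=
  upSet U = U ∧
    ∀ D : Set α, IsDirectedSet D → ∀ s : α, IsLUB D s → s ∈ U → (D ∩ U).Nonempty

/-- The Scott topology. -/
def scottTopology (α : Type*) [PartialOrder α] : TopologicalSpace α :=
  generateFrom {U | IsScottOpen U}

/-- `P` is exact: for every `x` the set `{y : y ≪_w x}` is directed with supremum `x`. -/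
def ExactPoset (α : Type*) [PartialOrder α] : Prop :=
  ∀ x : α, IsDirectedSet {y | WWB {y} {x}} ∧ IsLUB {y | WWB {y} {x}} x

/-- `x` is way below `y`: for every directed `D` whose sup exists,
`y ≤ sup D` implies `x ≤ d` for some `d ∈ D`. -/
def WayBelowPt [PartialOrder α] (x y : α) : Prop :=
  ∀ D : Set α, IsDirectedSet D → ∀ s : α, IsLUB D s → y ≤ s → ∃ d ∈ D, x ≤ d

/-- `G` is way below `H`: for every directed `D` whose sup exists,
`sup D ∈ ↑H` implies `d ∈ ↑G` for some `d ∈ D`. -/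
def WayBelowSet [PartialOrder α] (G H : Set α) : Prop :=
  ∀ D : Set α, IsDirectedSet D → ∀ s : α, IsLUB D s → s ∈ upSet H → ∃ d ∈ D, d ∈ upSet G

/-- `fin(x)`: all finite nonempty subsets `F` with `F ≪ x`. -/
def finWB [PartialOrder α] (x : α) : Set (Set α) :=
  {F | F.Finite ∧ F.Nonempty ∧ WayBelowSet F {x}}

/-- The relation `≪_w` is weakly increasing: `x ≪_w y ≤ z ≪_w u` implies `x ≪_w z`. -/
def WeaklyIncreasing (α : Type*) [PartialOrder α] : Prop :=
  ∀ x y z u : α, WWB {x} {y} → y ≤ z → WWB {z} {u} → WWB {x} {z}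

/-- A chain of sets, each meeting the finite set `F`, has an intersection meeting `F`. -/
theorem IsChain.sInter_inter_nonempty {c : Set (Set α)} (hc : IsChain (· ⊆ ·) c)
    (hne : c.Nonempty) {F : Set α} (hF : F.Finite) (hmeet : ∀ E ∈ c, (E ∩ F).Nonempty) :
    (⋂₀ c ∩ F).Nonempty := by
  obtain ⟨E₀, hE₀, hmin⟩ :=
    exists_minimalFor_of_wellFoundedLT (· ∈ c) (fun E => (E ∩ F).ncard) hne
  obtain ⟨f, hfE₀, hfF⟩ := hmeet E₀ hE₀
  refine ⟨f, fun E hE => ?_, hfF⟩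
  rcases hc.total hE₀ hE with h | h
  · exact h hfE₀
  · have hsub : E ∩ F ⊆ E₀ ∩ F := inter_subset_inter_left F h
    have hfin : (E₀ ∩ F).Finite := hF.subset inter_subset_right
    have heq := eq_of_subset_of_ncard_le hsub (hmin hE (ncard_le_ncard hsub hfin)) hfin
    exact (heq.symm ▸ ⟨hfE₀, hfF⟩ : f ∈ E ∩ F).1

/-- A form of Rudin's lemma: a lower set meeting every member of a directed family of finite
sets contains a directed set with the same property. -/
theorem DirectedFam.exists_isDirectedSet [PartialOrder α] {𝓕 : Set (Set α)}
    (h𝓕 : DirectedFam 𝓕) (hne : 𝓕.Nonempty) (hfin : ∀ F ∈ 𝓕, F.Finite) {L : Set α}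
    (hL : IsLowerSet L) (hmeet : ∀ F ∈ 𝓕, (L ∩ F).Nonempty) :
    ∃ D ⊆ L, IsDirectedSet D ∧ ∀ F ∈ 𝓕, (D ∩ F).Nonempty := by
  obtain ⟨E, hEL, ⟨hE, hEmeet⟩, hmin⟩ := zorn_superset_nonempty
    {E : Set α | IsLowerSet E ∧ ∀ F ∈ 𝓕, (E ∩ F).Nonempty}
    (fun c hc hchain hcne => ⟨⋂₀ c,
      ⟨isLowerSet_sInter fun E hE => (hc hE).1, fun F hF =>
        hchain.sInter_inter_nonempty hcne (hfin F hF) fun E hE => (hc hE).2 F hF⟩,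
      fun _ => sInter_subset_of_mem⟩)
    L ⟨hL, hmeet⟩
  have above : ∀ a ∈ E, ∃ F ∈ 𝓕, ∀ f ∈ E ∩ F, a ≤ f := by
    intro a ha
    by_contra! hcon
    have hmem : IsLowerSet (E \ Ici a) ∧ ∀ F ∈ 𝓕, ((E \ Ici a) ∩ F).Nonempty := by
      refine ⟨fun p q hqp hp => ⟨hE hqp hp.1, fun hq => hp.2 (le_trans hq hqp)⟩, ?_⟩
      intro F hF
      obtain ⟨f, ⟨hfE, hfF⟩, haf⟩ := hcon F hF
      exact ⟨f, ⟨hfE, haf⟩, hfF⟩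
    exact (hmin hmem sdiff_subset ha).2 le_rfl
  refine ⟨E, hEL, ⟨?_, fun a ha b hb => ?_⟩, hEmeet⟩
  · obtain ⟨F, hF⟩ := hne
    exact (hEmeet F hF).left
  · obtain ⟨F₁, hF₁, ha₁⟩ := above a ha
    obtain ⟨F₂, hF₂, hb₂⟩ := above b hb
    obtain ⟨F₃, hF₃, hsub⟩ := h𝓕 F₁ hF₁ F₂ hF₂
    obtain ⟨e, heE, heF⟩ := hEmeet F₃ hF₃
    obtain ⟨⟨f₁, hf₁, h₁⟩, ⟨f₂, hf₂, h₂⟩⟩ := hsub heF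
    exact ⟨e, heE, (ha₁ f₁ ⟨hE h₁ heE, hf₁⟩).trans h₁, (hb₂ f₂ ⟨hE h₂ heE, hf₂⟩).trans h₂⟩

theorem isDirectedSet_singleton [PartialOrder α] (x : α) : IsDirectedSet ({x} : Set α) :=
  ⟨singleton_nonempty x, by rintro a rfl b rfl; exact ⟨_, rfl, le_rfl, le_rfl⟩⟩

theorem WayBelowSet.wwb [PartialOrder α] {G H : Set α} (h : WayBelowSet G H) : WWB G H :=
  fun D hD s hs hsH => h D hD s hs ⟨s, hsH, le_rfl⟩

theorem WWB.mem_upSet [PartialOrder α] {G : Set α} {x : α} (h : WWB G {x}) : x ∈ upSet G := by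
  obtain ⟨d, rfl, hd⟩ := h {x} (isDirectedSet_singleton x) x isLUB_singleton rfl
  exact hd

theorem WWB.inter_Iic [PartialOrder α] {G : Set α} {x : α} (h : WWB G {x}) :
    WWB (G ∩ Iic x) {x} := by
  rintro D hD s hs rfl
  obtain ⟨d, hdD, g, hg, hgd⟩ := h D hD s hs rfl
  exact ⟨d, hdD, g, ⟨hg, hgd.trans (hs.1 hdD)⟩, hgd⟩

theorem inter_Iic_mem_finW [PartialOrder α] {G : Set α} {x : α} (h : G ∈ finW x) :
    G ∩ Iic x ∈ finW x := by
  obtain ⟨g, hg, -⟩ := h.2.2.inter_Iic.mem_upSet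
  exact ⟨h.1.subset inter_subset_left, ⟨g, hg⟩, h.2.2.inter_Iic⟩

theorem finWB_subset_finW [PartialOrder α] (x : α) : finWB x ⊆ finW x :=
  fun _ hG => ⟨hG.1, hG.2.1, hG.2.2.wwb⟩

theorem finWB_nonempty [PartialOrder α] {x : α}
    (hx : (⋂ F ∈ finWB x, upSet F) = upSet {x}) : (finWB x).Nonempty := by
  by_contra! hempty
  have hbot : ∀ y, x ≤ y := by
    intro y
    have hy : y ∈ upSet {x} := by rw [← hx, hempty]; simp
    obtain ⟨_, rfl, h⟩ := hy
    exact h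
  have hmem : {x} ∈ finWB x := by
    refine ⟨finite_singleton x, singleton_nonempty x, fun D hD _ _ _ => ?_⟩
    obtain ⟨d, hdD⟩ := hD.1
    exact ⟨d, hdD, x, rfl, hbot d⟩
  simp [hempty] at hmem

/-- In a quasicontinuous domain, a set weakly way below `x` lies, up to upper closure, below
the part under `x` of some finite set way below `x`. -/
theorem WWB.exists_finWB_inter_Iic_subset [PartialOrder α] (hd : IsDcpo α) {x : α}
    (hdir : DirectedFam (finWB x)) (hx : (⋂ F ∈ finWB x, upSet F) = upSet {x}) {F : Set α}
    (hF : WWB F {x}) : ∃ G ∈ finWB x, G ∩ Iic x ⊆ upSet F := by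
  by_contra! hcon
  have hlower : IsLowerSet (Iic x \ upSet F) := fun p q hqp hp =>
    ⟨hqp.trans hp.1, fun ⟨f, hf, hfq⟩ => hp.2 ⟨f, hf, hfq.trans hqp⟩⟩
  obtain ⟨D, hDL, hD, hDmeet⟩ := hdir.exists_isDirectedSet (finWB_nonempty hx)
    (fun G hG => hG.1) hlower fun G hG => by
      obtain ⟨g, ⟨hgG, hgx⟩, hgF⟩ := not_subset.1 (hcon G hG)
      exact ⟨g, ⟨hgx, hgF⟩, hgG⟩
  obtain ⟨s, hs⟩ := hd D hD
  have hsx : s ≤ x := hs.2 fun d hdD => (hDL hdD).1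
  have hmem : s ∈ upSet {x} := by
    rw [← hx]
    refine mem_iInter₂.2 fun G hG => ?_
    obtain ⟨g, hgD, hgG⟩ := hDmeet G hG
    exact ⟨g, hgG, hs.1 hgD⟩
  obtain ⟨_, rfl, hxs⟩ := hmem
  obtain ⟨d, hdD, hdF⟩ := hF D hD s hs (le_antisymm hsx hxs)
  exact (hDL hdD).2 hdF

/-- Every quasicontinuous domain is quasiexact. -/
theorem quasicontinuous_domain_is_quasiexact [PartialOrder α] (hd : IsDcpo α)
    (hqc : ∀ x : α, DirectedFam (finWB x) ∧ (⋂ F ∈ finWB x, upSet F) = upSet {x}) :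
    Quasiexact α := by
  intro x
  obtain ⟨hdir, hx⟩ := hqc x
  refine ⟨fun F₁ hF₁ F₂ hF₂ => ?_, subset_antisymm ?_ ?_⟩
  · obtain ⟨G₁, hG₁, h₁⟩ := hF₁.2.2.exists_finWB_inter_Iic_subset hd hdir hx
    obtain ⟨G₂, hG₂, h₂⟩ := hF₂.2.2.exists_finWB_inter_Iic_subset hd hdir hx
    obtain ⟨G₃, hG₃, hsub⟩ := hdir G₁ hG₁ G₂ hG₂
    refine ⟨G₃ ∩ Iic x, inter_Iic_mem_finW (finWB_subset_finW x hG₃), ?_⟩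
    rintro g ⟨hg, hgx⟩
    obtain ⟨⟨g₁, hg₁, hle₁⟩, ⟨g₂, hg₂, hle₂⟩⟩ := hsub hg
    obtain ⟨f₁, hf₁, hfg₁⟩ := h₁ ⟨hg₁, hle₁.trans hgx⟩
    obtain ⟨f₂, hf₂, hfg₂⟩ := h₂ ⟨hg₂, hle₂.trans hgx⟩
    exact ⟨⟨f₁, hf₁, hfg₁.trans hle₁⟩, ⟨f₂, hf₂, hfg₂.trans hle₂⟩⟩
  · rw [← hx]
    exact biInter_subset_biInter_left (finWB_subset_finW x)
  · rintro y ⟨_, rfl, hxy⟩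
    refine mem_iInter₂.2 fun F hF => ?_
    obtain ⟨f, hf, hfx⟩ := hF.2.2.mem_upSet
    exact ⟨f, hf, hfx.trans hxy⟩
end

section
/- A dcpo P is exact if and only if for every x ∈ P there exists a directed subset D ⊆ {y ∈ P : y ≪_w x} such that sup D = x. -/
open Set TopologicalSpace

variable {α : Type*}

theorem WWB.exists_mem_le [PartialOrder α] {x y : α} (h : WWB {y} {x}) {D : Set α}
    (hD : IsDirectedSet D) (hx : IsLUB D x) : ∃ d ∈ D, y ≤ d := by
  obtain ⟨d, hd, _, rfl, hle⟩ := h D hD x hx rfl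
  exact ⟨d, hd, hle⟩

theorem WWB.le [PartialOrder α] {x y : α} (h : WWB {y} {x}) : y ≤ x := by
  obtain ⟨_, rfl, hle⟩ := h.exists_mem_le (isDirectedSet_singleton x) isLUB_singleton
  exact hle

/-- A dcpo is exact iff for every `x` there is a directed
`D ⊆ {y : y ≪_w x}` with `sup D = x`. -/
theorem exact_iff_exists_directed_subset_wwb_sup [PartialOrder α] (hd : IsDcpo α) :
    ExactPoset α ↔
      ∀ x : α, ∃ D : Set α, D ⊆ {y | WWB {y} {x}} ∧ IsDirectedSet D ∧ IsLUB D x := by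
  refine ⟨fun h x => ⟨_, Subset.rfl, h x⟩, fun h x => ?_⟩
  obtain ⟨D, hDx, hD, hlub⟩ := h x
  refine ⟨⟨hD.1.mono hDx, fun a ha b hb => ?_⟩, fun y hy => WWB.le hy,
    fun u hu => hlub.2 fun d hd => hu (hDx hd)⟩
  obtain ⟨d, hd, had⟩ := WWB.exists_mem_le ha hD hlub
  obtain ⟨e, he, hbe⟩ := WWB.exists_mem_le hb hD hlub
  obtain ⟨c, hc, hdc, hec⟩ := hD.2 d hd e he
  exact ⟨c, hDx hc, had.trans hdc, hbe.trans hec⟩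
end
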